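/- Let A_n and B_n be independent real random variables on a sequence of probability spaces, such that A_n converges in distribution to N(0,σ₁²) and A_n + B_n converges in distribution to N(0,σ₁²+σ₂²). Then B_n converges in distribution to N(0,σ₂²). -/

import Mathlib

open MeasureTheory ProbabilityTheory Filter
open scoped NNReal

/-- Convergence of the expectations of all bounded continuous test functions is equivalent to
pointwise convergence of the characteristic functions of the laws. -/
lemma tendsto_integral_comp_iff_tendsto_charFun_map
    {Ω : ℕ → Type*} [∀ n, MeasurableSpace (Ω n)] {P : ∀ n, Measure (Ω n)}
    [∀ n, IsProbabilityMeasure (P n)] {X : ∀ n, Ω n → ℝ} (hX : ∀ n, Measurable (X n))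
    (μ : Measure ℝ) [IsProbabilityMeasure μ] :
    (∀ f : BoundedContinuousFunction ℝ ℝ,
      Tendsto (fun n => ∫ ω, f (X n ω) ∂(P n)) atTop (nhds (∫ x, f x ∂μ))) ↔
    ∀ t, Tendsto (fun n => charFun ((P n).map (X n)) t) atTop (nhds (charFun μ t)) := by
  let law : ℕ → ProbabilityMeasure ℝ := fun n =>
    ⟨(P n).map (X n), Measure.isProbabilityMeasure_map (hX n).aemeasurable⟩
  let limit : ProbabilityMeasure ℝ := ⟨μ, inferInstance⟩
  have integral_law (f : BoundedContinuousFunction ℝ ℝ) (n : ℕ) :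
      ∫ x, f x ∂(law n : Measure ℝ) = ∫ ω, f (X n ω) ∂(P n) :=
    integral_map (hX n).aemeasurable f.continuous.aestronglyMeasurable
  have h := (ProbabilityMeasure.tendsto_iff_forall_integral_tendsto (μs := law) (μ := limit)
    (F := atTop)).symm.trans ProbabilityMeasure.tendsto_iff_tendsto_charFun
  simp_rw [integral_law] at h
  exact h

/-- The characteristic function of a real Gaussian measure has no zeros. -/
lemma charFun_gaussianReal_ne_zero (m : ℝ) (v : ℝ≥0) (t : ℝ) :
    charFun (gaussianReal m v) t ≠ 0 := by
  rw [charFun_gaussianReal]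
  exact Complex.exp_ne_zero _

theorem indep_sum_gaussian_limit
    (Ω : ℕ → Type*) [∀ n, MeasurableSpace (Ω n)] (P : ∀ n, Measure (Ω n))
    [∀ n, IsProbabilityMeasure (P n)]
    (A B : ∀ n, Ω n → ℝ) (hA : ∀ n, Measurable (A n)) (hB : ∀ n, Measurable (B n))
    (hindep : ∀ n, IndepFun (A n) (B n) (P n))
    (σ₁ σ₂ : ℝ≥0)
    (hAlim : ∀ f : BoundedContinuousFunction ℝ ℝ,
      Tendsto (fun n => ∫ ω, f (A n ω) ∂(P n)) atTop
        (nhds (∫ x, f x ∂(gaussianReal 0 σ₁))))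
    (hABlim : ∀ f : BoundedContinuousFunction ℝ ℝ,
      Tendsto (fun n => ∫ ω, f (A n ω + B n ω) ∂(P n)) atTop
        (nhds (∫ x, f x ∂(gaussianReal 0 (σ₁ + σ₂))))) :
    ∀ f : BoundedContinuousFunction ℝ ℝ,
      Tendsto (fun n => ∫ ω, f (B n ω) ∂(P n)) atTop
        (nhds (∫ x, f x ∂(gaussianReal 0 σ₂))) := by
  rw [tendsto_integral_comp_iff_tendsto_charFun_map hA] at hAlim
  rw [tendsto_integral_comp_iff_tendsto_charFun_map (X := fun n ω => A n ω + B n ω)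
    fun n => (hA n).add (hB n)] at hABlim
  rw [tendsto_integral_comp_iff_tendsto_charFun_map hB]
  intro t
  have hlimit : charFun (gaussianReal 0 σ₂) t =
      charFun (gaussianReal 0 (σ₁ + σ₂)) t / charFun (gaussianReal 0 σ₁) t := by
    rw [eq_div_iff (charFun_gaussianReal_ne_zero 0 σ₁ t), mul_comm, ← charFun_conv,
      gaussianReal_conv_gaussianReal, add_zero]
  rw [hlimit]
  refine ((hABlim t).div (hAlim t) (charFun_gaussianReal_ne_zero 0 σ₁ t)).congr' ?_
  filter_upwards [(hAlim t).eventually_ne (charFun_gaussianReal_ne_zero 0 σ₁ t)] with n hn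
  rw [Pi.div_apply, (hindep n).charFun_map_fun_add_eq_mul (hA n).aemeasurable
      (hB n).aemeasurable,
    Pi.mul_apply, mul_div_cancel_left₀ _ hn]
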